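/- Let 𝐗 and 𝐘 be disjoint nonempty node sets in a DAG D. If there is no directed path of nonzero length from one node of 𝐗 to another node of 𝐗 in D, then the following are equivalent: (i) there exists a set disjoint from 𝐗 ∪ 𝐘 satisfying the adjustment criterion relative to (𝐗,𝐘) in D; (ii) there exists a back-door set relative to (𝐗,𝐘) in D. -/

import Mathlib

attribute [local instance] Classical.propDecidable

/-- A finite directed acyclic graph on vertex type `V`. -/
structure DAG (V : Type) [Fintype V] [DecidableEq V] where
  /-- the edge relation: `Edge a b` means there is a directed edge `a → b` -/
  Edge : V → V → Prop
  /-- there are no directed cycles -/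
  acyclic : ∀ v, ¬ Relation.TransGen Edge v v

namespace DAG

variable {V : Type} [Fintype V] [DecidableEq V]

/-- two nodes are adjacent if they are joined by an edge in either direction -/
def Adj (D : DAG V) (a b : V) : Prop := D.Edge a b ∨ D.Edge b a

/-- `p` is a path from `x` to `y`: a list of distinct nodes, consecutive ones adjacent,
starting at `x` and ending at `y`. -/
def IsPathFrom (D : DAG V) (p : List V) (x y : V) : Prop :=
  p.Nodup ∧ p.Chain' D.Adj ∧ p.head? = some x ∧ p.getLast? = some y

/-- a causal (directed) path: all edges point forward -/
def IsCausal (D : DAG V) (p : List V) : Prop := p.Chain' D.Edge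

/-- descendants of a set of nodes (every node is its own descendant) -/
def Desc (D : DAG V) (S : Set V) : Set V :=
  {v | ∃ w ∈ S, Relation.ReflTransGen D.Edge w v}

/-- ancestors of a set of nodes (every node is its own ancestor) -/
def Anc (D : DAG V) (S : Set V) : Set V :=
  {v | ∃ w ∈ S, Relation.ReflTransGen D.Edge v w}

/-- `w` is a collider on the path `p`: both edges of `p` at `w` point into `w` -/
def IsColliderOn (D : DAG V) (p : List V) (w : V) : Prop :=
  ∃ a b, [a, w, b] <:+: p ∧ D.Edge a w ∧ D.Edge b w

/-- `w` is a non-collider on `p`: a non-endpoint node of `p` that is not a collider on `p` -/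
def IsNonColliderOn (D : DAG V) (p : List V) (w : V) : Prop :=
  (∃ a b, [a, w, b] <:+: p) ∧ ¬ D.IsColliderOn p w

/-- `Z` blocks the path `p`: some non-collider on `p` is in `Z`, or some collider on `p`
has no descendant in `Z`.  Otherwise `p` is d-connecting given `Z`. -/
def Blocks (D : DAG V) (Z : Set V) (p : List V) : Prop :=
  (∃ w, D.IsNonColliderOn p w ∧ w ∈ Z) ∨
  (∃ w, D.IsColliderOn p w ∧ D.Desc {w} ∩ Z = ∅)

/-- `p` is a proper causal path from `X` to `Y` -/
def ProperCausalPath (D : DAG V) (X Y : Set V) (p : List V) : Prop :=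
  (∃ x ∈ X, ∃ y ∈ Y, D.IsPathFrom p x y) ∧ (∀ v ∈ p.tail, v ∉ X) ∧ D.IsCausal p

/-- `p` is a proper non-causal path from `X` to `Y` -/
def ProperNonCausalPath (D : DAG V) (X Y : Set V) (p : List V) : Prop :=
  (∃ x ∈ X, ∃ y ∈ Y, D.IsPathFrom p x y) ∧ (∀ v ∈ p.tail, v ∉ X) ∧ ¬ D.IsCausal p

/-- the forbidden set: all descendants of nodes `W ∉ X` lying on a proper causal path
from `X` to `Y` -/
def Forb (D : DAG V) (X Y : Set V) : Set V :=
  {v | ∃ p w, D.ProperCausalPath X Y p ∧ w ∈ p ∧ w ∉ X ∧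
    Relation.ReflTransGen D.Edge w v}

/-- the adjustment criterion of Shpitser et al. / van der Zander et al. -/
def SatisfiesAC (D : DAG V) (X Y Z : Set V) : Prop :=
  Z ∩ D.Forb X Y = ∅ ∧ ∀ p, D.ProperNonCausalPath X Y p → D.Blocks Z p

/-- the constructive set `Adjust(X,Y,D)` -/
def AdjustSet (D : DAG V) (X Y : Set V) : Set V :=
  D.Anc (X ∪ Y) \ (X ∪ Y ∪ D.Forb X Y)

/-- `Z` d-separates `X` and `Y` in `D`: `Z` blocks every path from `X` to `Y` -/
def DSep (D : DAG V) (X Y Z : Set V) : Prop :=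
  ∀ x ∈ X, ∀ y ∈ Y, ∀ p, D.IsPathFrom p x y → D.Blocks Z p

/-- `p` is a back-door path from `x`: its first edge points into `x` -/
def IsBackdoorFrom (D : DAG V) (p : List V) (x : V) : Prop :=
  ∃ b rest, p = x :: b :: rest ∧ D.Edge b x

/-- Pearl's back-door criterion -/
def BackdoorCriterion (D : DAG V) (X Y Z : Set V) : Prop :=
  Z ∩ D.Desc X = ∅ ∧
  ∀ x ∈ X, ∀ y ∈ Y, ∀ p, D.IsPathFrom p x y → D.IsBackdoorFrom p x → D.Blocks Z p

/-- the generalized back-door criterion of Maathuis and Colombo -/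
def GenBackdoorCriterion (D : DAG V) (X Y Z : Set V) : Prop :=
  Z ∩ D.Desc X = ∅ ∧
  ∀ x ∈ X, ∀ y ∈ Y, ∀ p, D.IsPathFrom p x y → D.IsBackdoorFrom p x →
    D.Blocks ((Z ∪ X) \ {x}) p

end DAG


namespace DAG

variable {V : Type} [Fintype V] [DecidableEq V]

/-- In a list without repetitions, the neighbours of an inner entry are determined by it. -/
theorem neighbors_unique {α : Type*} {p : List α} (hp : p.Nodup) {a b a' b' w : α}
    (h : [a, w, b] <:+: p) (h' : [a', w, b'] <:+: p) : a = a' ∧ b = b' := by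
  obtain ⟨s, t, rfl⟩ := h
  obtain ⟨s', t', h⟩ := h'
  have hn : (s' ++ [a', w, b'] ++ t').Nodup := h ▸ hp
  have e : (s' ++ [a']) ++ w :: (b' :: t') = (s ++ [a]) ++ w :: (b :: t) := by simpa using h
  have h1 : w ∉ s' ++ [a'] ∧ w ∉ b' :: t' := by
    simp [List.nodup_append] at hn ⊢
    grind
  obtain ⟨e1, -, e2⟩ := (List.append_cons_inj_of_notMem h1.1 h1.2).1 e
  exact ⟨(List.cons.inj (List.append_inj' e1 rfl).2).1.symm, (List.cons.inj e2).1.symm⟩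

theorem IsColliderOn.of_infix {D : DAG V} {q p : List V} {w : V} (h : D.IsColliderOn q w)
    (hqp : q <:+: p) : D.IsColliderOn p w := by
  obtain ⟨a, b, hi, ha, hb⟩ := h
  exact ⟨a, b, hi.trans hqp, ha, hb⟩

theorem IsNonColliderOn.of_infix {D : DAG V} {q p : List V} {w : V} (h : D.IsNonColliderOn q w)
    (hqp : q <:+: p) (hp : p.Nodup) : D.IsNonColliderOn p w := by
  obtain ⟨⟨a, b, hi⟩, hc⟩ := h
  refine ⟨⟨a, b, hi.trans hqp⟩, ?_⟩
  rintro ⟨a', b', hi', ha, hb⟩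
  obtain ⟨rfl, rfl⟩ := neighbors_unique hp (hi.trans hqp) hi'
  exact hc ⟨a, b, hi, ha, hb⟩

/-- A set blocking a subpath blocks the whole path. -/
theorem Blocks.of_infix {D : DAG V} {Z : Set V} {q p : List V} (h : D.Blocks Z q)
    (hqp : q <:+: p) (hp : p.Nodup) : D.Blocks Z p := by
  rcases h with ⟨w, hw, hZ⟩ | ⟨w, hw, hZ⟩
  · exact .inl ⟨w, hw.of_infix hqp hp, hZ⟩
  · exact .inr ⟨w, hw.of_infix hqp, hZ⟩

/-- A non-causal path that starts with a forward edge has a collider which is a descendant of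
its first node. -/
theorem exists_collider_of_not_isCausal (D : DAG V) (rest : List V) : ∀ a b : V,
    (a :: b :: rest).IsChain D.Adj → D.Edge a b → ¬ D.IsCausal (a :: b :: rest) →
      ∃ w, D.IsColliderOn (a :: b :: rest) w ∧ Relation.ReflTransGen D.Edge a w := by
  induction rest with
  | nil =>
    intro a b _ hab hc
    exact absurd (List.isChain_pair.2 hab) hc
  | cons c rest ih =>
    intro a b hch hab hc
    rw [List.isChain_cons_cons] at hch
    rcases (List.isChain_cons_cons.1 hch.2).1 with hbc | hcb
    · have hc' : ¬ D.IsCausal (b :: c :: rest) := fun h => hc (List.isChain_cons_cons.2 ⟨hab, h⟩)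
      obtain ⟨w, hw, hr⟩ := ih b c hch.2 hbc hc'
      exact ⟨w, hw.of_infix (List.suffix_cons _ _).isInfix, .head hab hr⟩
    · exact ⟨b, ⟨a, c, ⟨[], rest, by simp⟩, hab, hcb⟩, .single hab⟩

/-- The nodes of `Y` can be removed from a set blocking all back-door paths from `x` to `Y`. -/
theorem blocks_diff_of_blocks_backdoor {D : DAG V} {Y Z : Set V} {x : V}
    (hZ : ∀ y ∈ Y, ∀ p, D.IsPathFrom p x y → D.IsBackdoorFrom p x → D.Blocks Z p)
    {y : V} (hy : y ∈ Y) {p : List V} (hp : D.IsPathFrom p x y) (hb : D.IsBackdoorFrom p x) :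
    D.Blocks (Z \ Y) p := by
  induction hn : p.length using Nat.strong_induction_on generalizing p y with
  | _ n ih =>
    rcases hZ y hy p hp hb with ⟨w, hw, hwZ⟩ | ⟨w, hw, hwZ⟩
    · by_cases hwY : w ∈ Y
      · obtain ⟨⟨a, b, s, t, rfl⟩, -⟩ := hw
        have hpre : s ++ [a, w] <+: s ++ [a, w, b] ++ t := ⟨b :: t, by simp⟩
        have hpath : D.IsPathFrom (s ++ [a, w]) x w := by
          refine ⟨hp.1.sublist hpre.sublist, List.IsChain.infix hp.2.1 hpre.isInfix, ?_, by simp⟩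
          have := hp.2.2.1
          cases s <;> simpa using this
        have hback : D.IsBackdoorFrom (s ++ [a, w]) x := by
          obtain ⟨c, rest, he, hc⟩ := hb
          rcases s with _ | ⟨s₁, _ | ⟨s₂, s⟩⟩ <;> simp at he <;>
            simp [IsBackdoorFrom] <;> grind
        exact (ih _ (by simp at hn ⊢; omega) hwY hpath hback rfl).of_infix hpre.isInfix hp.1
      · exact .inl ⟨w, hw, hwZ, hwY⟩
    · refine .inr ⟨w, hw, ?_⟩
      rw [Set.eq_empty_iff_forall_notMem] at hwZ ⊢
      exact fun v hv => hwZ v ⟨hv.1, hv.2.1⟩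

theorem forb_subset_desc (D : DAG V) (X Y : Set V) : D.Forb X Y ⊆ D.Desc X := by
  rintro v ⟨p, w, ⟨⟨x, hx, y, -, hp⟩, -, hc⟩, hw, -, hwv⟩
  refine ⟨x, hx, .trans ?_ hwv⟩
  obtain ⟨l, rfl⟩ : ∃ l, p = x :: l := by
    rcases p with _ | ⟨a, l⟩
    · simp at hw
    · exact ⟨l, by simpa using hp.2.2.1⟩
  exact List.IsChain.induction (Relation.ReflTransGen D.Edge x) (x :: l) hc
    (fun _ _ h h' => h'.tail h) (fun _ => .refl) w hw

/-- If there is no directed path of nonzero length from a node of `X`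
to a node of `X` in `D`, then a set disjoint from `X ∪ Y` satisfying the adjustment
criterion relative to `(X, Y)` exists iff a back-door set relative to `(X, Y)`
exists. -/
theorem ac_iff_backdoor_of_no_directed_path_within_X
    (D : DAG V) (X Y : Set V)
    (hXY : Disjoint X Y) (hX : X.Nonempty) (hY : Y.Nonempty)
    (hnopath : ¬ ∃ x₁ ∈ X, ∃ x₂ ∈ X, Relation.TransGen D.Edge x₁ x₂) :
    (∃ Z, Disjoint Z (X ∪ Y) ∧ D.SatisfiesAC X Y Z) ↔
      (∃ Z, D.BackdoorCriterion X Y Z) := by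
  constructor
  · rintro ⟨Z, -, -, hZ⟩
    have hpa : ∀ x ∈ X, ∀ b, D.Edge b x → b ∉ Y := by
      intro x hx b hbx hbY
      have hbX : b ∉ X := fun h => hXY.ne_of_mem h hbY rfl
      have hne : x ≠ b := fun h => hbX (h ▸ hx)
      have hcausal : ¬ D.IsCausal [x, b] := fun h =>
        D.acyclic x (.tail (.single (List.isChain_pair.1 h)) hbx)
      have hpath : D.IsPathFrom [x, b] x b :=
        ⟨by simpa using hne, List.isChain_pair.2 (.inr hbx), rfl, rfl⟩
      have hlen : ∀ a w c : V, ¬ [a, w, c] <:+: [x, b] := fun a w c h => by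
        simpa using h.length_le
      rcases hZ [x, b] ⟨⟨x, hx, b, hbY, hpath⟩, by simpa using hbX, hcausal⟩ with
        ⟨w, ⟨⟨a, c, h⟩, -⟩, -⟩ | ⟨w, ⟨a, c, h, -⟩, -⟩ <;> exact hlen _ _ _ h
    refine ⟨{b | ∃ x ∈ X, D.Edge b x}, ?_, ?_⟩
    · rw [Set.eq_empty_iff_forall_notMem]
      rintro b ⟨⟨x, hx, hbx⟩, x', hx', hr⟩
      exact hnopath ⟨x', hx', x, hx, .tail' hr hbx⟩
    · rintro x hx y hy p hp ⟨b, rest, rfl, hbx⟩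
      have hbY := hpa x hx b hbx
      rcases rest with _ | ⟨c, rest⟩
      · have hby : b = y := by simpa using hp.2.2.2
        exact absurd (hby ▸ hy) hbY
      · have hi : [x, b, c] <:+: x :: b :: c :: rest := ⟨[], rest, by simp⟩
        refine .inl ⟨b, ⟨⟨x, c, hi⟩, ?_⟩, x, hx, hbx⟩
        rintro ⟨a, d, hi', hab, -⟩
        obtain ⟨rfl, -⟩ := neighbors_unique hp.1 hi hi'
        exact D.acyclic x (.tail (.single hab) hbx)
  · rintro ⟨Z, hZ, hblock⟩
    rw [Set.eq_empty_iff_forall_notMem] at hZ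
    have hZX : ∀ v ∈ Z, v ∉ D.Desc X := fun v hv hv' => hZ v ⟨hv, hv'⟩
    refine ⟨Z \ Y, ?_, ?_, ?_⟩
    · rw [Set.disjoint_left]
      rintro v ⟨hv, hvY⟩ (hvX | hvY')
      · exact hZX v hv ⟨v, hvX, .refl⟩
      · exact hvY hvY'
    · rw [Set.eq_empty_iff_forall_notMem]
      exact fun v hv => hZX v hv.1.1 (D.forb_subset_desc X Y hv.2)
    · rintro p ⟨⟨x, hx, y, hy, hp⟩, -, hc⟩
      rcases p with _ | ⟨a, _ | ⟨b, rest⟩⟩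
      · exact absurd .nil hc
      · exact absurd (.singleton a) hc
      · obtain rfl : a = x := by simpa using hp.2.2.1
        rcases (List.isChain_cons_cons.1 hp.2.1).1 with hab | hba
        · obtain ⟨w, hw, haw⟩ := D.exists_collider_of_not_isCausal rest a b hp.2.1 hab hc
          refine .inr ⟨w, hw, ?_⟩
          rw [Set.eq_empty_iff_forall_notMem]
          rintro v ⟨⟨w', rfl, hwv⟩, hv, -⟩
          exact hZX v hv ⟨a, hx, haw.trans hwv⟩
        · exact blocks_diff_of_blocks_backdoor (hblock a hx) hy hp ⟨b, rest, rfl, hba⟩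

end DAG
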